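/- For every formula F of nPC and all i, j, k ∈ {1,…,n} with i ≠ k, the sequent F^{(ij)}, F^{(kj)} ⊢_j (with empty right-hand side) is provable in nPC. -/

import Mathlib

/-- Formulas of the n-dimensional propositional calculus nPC:
decorated variables `X^π`, constants `e_k`, and compounds `q(F,G_1,…,G_n)`.
Dimensions are elements of `Fin n`; propositional variables are natural numbers. -/
inductive Fm (n : ℕ) : Type where
  | var (X : ℕ) (π : Equiv.Perm (Fin n)) : Fm n
  | const (k : Fin n) : Fm n
  | q (F : Fm n) (G : Fin n → Fm n) : Fm n

/-- The action `F^ρ` of a permutation `ρ` on a formula. -/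
def Fm.act {n : ℕ} (ρ : Equiv.Perm (Fin n)) : Fm n → Fm n
  | .var X π => .var X (ρ * π)
  | .const k => .const (ρ k)
  | .q F G => .q F (fun j => (G j).act ρ)

/-- The action of a permutation on a multiset of formulas (context). -/
def actM {n : ℕ} (ρ : Equiv.Perm (Fin n)) (Γ : Multiset (Fm n)) : Multiset (Fm n) :=
  Γ.map (Fm.act ρ)

/-- The sequent calculus of nPC: `Proves Γ i Δ` means the sequent `Γ ⊢_i Δ` is provable. -/
inductive Proves {n : ℕ} : Multiset (Fm n) → Fin n → Multiset (Fm n) → Prop where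
  | const (i : Fin n) : Proves 0 i {Fm.const i}
  | id (X : ℕ) (π ρ : Equiv.Perm (Fin n)) (i : Fin n) (h : π⁻¹ i = ρ⁻¹ i) :
      Proves {Fm.var X π} i {Fm.var X ρ}
  | sym (Γ Δ : Multiset (Fm n)) (i j : Fin n)
      (h : Proves (actM (Equiv.swap i j) Γ) i (actM (Equiv.swap i j) Δ)) :
      Proves Γ j Δ
  | neg1 (Γ Δ : Multiset (Fm n)) (F : Fm n) (i j k : Fin n) (hik : i ≠ k)
      (h : Proves (actM (Equiv.swap i j) Γ) i (F ::ₘ actM (Equiv.swap i j) Δ)) :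
      Proves (F.act (Equiv.swap j k) ::ₘ Γ) j Δ
  | neg2 (Γ Δ : Multiset (Fm n)) (F : Fm n) (i j k : Fin n) (hjk : j ≠ k)
      (h : Proves (actM (Equiv.swap i j) Γ) i (F ::ₘ actM (Equiv.swap i j) Δ)) :
      Proves (F.act (Equiv.swap i k) ::ₘ Γ) j Δ
  | neg3 (Γ Δ : Multiset (Fm n)) (F : Fm n) (j : Fin n)
      (h : ∀ i : Fin n, i ≠ j →
        Proves (F ::ₘ actM (Equiv.swap i j) Γ) i (actM (Equiv.swap i j) Δ)) :
      Proves Γ j (F ::ₘ Δ)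
  | qL (Γ Δ : Multiset (Fm n)) (F : Fm n) (G : Fin n → Fm n) (i : Fin n)
      (h : ∀ j : Fin n,
        Proves ((G j).act (Equiv.swap j i) ::ₘ F ::ₘ actM (Equiv.swap j i) Γ) j
          (actM (Equiv.swap j i) Δ)) :
      Proves (Fm.q F G ::ₘ Γ) i Δ
  | qR (Γ Δ : Multiset (Fm n)) (F : Fm n) (G : Fin n → Fm n) (i : Fin n)
      (h : ∀ j : Fin n,
        Proves (F ::ₘ actM (Equiv.swap j i) Γ) j
          ((G j).act (Equiv.swap j i) ::ₘ actM (Equiv.swap j i) Δ)) :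
      Proves Γ i (Fm.q F G ::ₘ Δ)
  | cut (Γ Δ : Multiset (Fm n)) (F : Fm n) (i : Fin n)
      (h1 : Proves (F ::ₘ Γ) i Δ) (h2 : Proves Γ i (F ::ₘ Δ)) : Proves Γ i Δ
  | weakL (Γ Δ : Multiset (Fm n)) (F : Fm n) (i : Fin n)
      (h : Proves Γ i Δ) : Proves (F ::ₘ Γ) i Δ
  | weakR (Γ Δ : Multiset (Fm n)) (F : Fm n) (i : Fin n)
      (h : Proves Γ i Δ) : Proves Γ i (F ::ₘ Δ)
  | conL (Γ Δ : Multiset (Fm n)) (F : Fm n) (i : Fin n)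
      (h : Proves (F ::ₘ F ::ₘ Γ) i Δ) : Proves (F ::ₘ Γ) i Δ
  | conR (Γ Δ : Multiset (Fm n)) (F : Fm n) (i : Fin n)
      (h : Proves Γ i (F ::ₘ F ::ₘ Δ)) : Proves Γ i (F ::ₘ Δ)

/-- The semantics `⟦F⟧v` of a formula in an environment `v`. -/
def Fm.sem {n : ℕ} (v : ℕ → Fin n) : Fm n → Fin n
  | .var X π => π (v X)
  | .const k => k
  | .q F G => (G (F.sem v)).sem v

/-- `Γ ⊨_i Δ`: every environment making all of `Γ` equal `i` makes some formula of `Δ` equal `i`. -/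
def Models {n : ℕ} (Γ : Multiset (Fm n)) (i : Fin n) (Δ : Multiset (Fm n)) : Prop :=
  ∀ v : ℕ → Fin n, (∀ G ∈ Γ, Fm.sem v G = i) → ∃ F ∈ Δ, Fm.sem v F = i

/-- Logical equivalence `F ∼ G`: both `F ⊢_i G` and `G ⊢_i F` are provable for every `i`. -/
def Eqv {n : ℕ} (F G : Fm n) : Prop :=
  ∀ i : Fin n, Proves {F} i {G} ∧ Proves {G} i {F}

/-- Provability from a (possibly infinite) set of hypotheses:
some finite sub-multiset of `Γ` proves `Δ` at `i`. -/
def ProvesSet {n : ℕ} (Γ : Set (Fm n)) (i : Fin n) (Δ : Multiset (Fm n)) : Prop :=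
  ∃ Γ' : Multiset (Fm n), (∀ G ∈ Γ', G ∈ Γ) ∧ Proves Γ' i Δ

/-- `Γ ⊨_i F` for a set `Γ` of hypotheses. -/
def ModelsSet {n : ℕ} (Γ : Set (Fm n)) (i : Fin n) (F : Fm n) : Prop :=
  ∀ v : ℕ → Fin n, (∀ G ∈ Γ, Fm.sem v G = i) → Fm.sem v F = i

theorem Fm.act_one {n : ℕ} (F : Fm n) : F.act 1 = F := by
  induction F with
  | var X π => simp [Fm.act]
  | const k => simp [Fm.act]
  | q F G _ ihG => simp [Fm.act, ihG]

theorem Fm.act_act {n : ℕ} (σ ρ : Equiv.Perm (Fin n)) (F : Fm n) :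
    (F.act ρ).act σ = F.act (σ * ρ) := by
  induction F with
  | var X π => simp [Fm.act, mul_assoc]
  | const k => simp [Fm.act]
  | q F G _ ihG => simp [Fm.act, ihG]

theorem Fm.act_swap_act_swap {n : ℕ} (i j : Fin n) (F : Fm n) :
    (F.act (Equiv.swap i j)).act (Equiv.swap i j) = F := by
  rw [Fm.act_act, Equiv.swap_mul_self, Fm.act_one]

theorem Proves.weaken_left {n : ℕ} {Γ Δ : Multiset (Fm n)} {i : Fin n} (h : Proves Γ i Δ)
    (Γ' : Multiset (Fm n)) : Proves (Γ' + Γ) i Δ := by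
  induction Γ' using Multiset.induction with
  | empty => simpa using h
  | cons F Γ' ih => simpa using ih.weakL _ _ F _

theorem Proves.mono_left {n : ℕ} {Γ Γ' Δ : Multiset (Fm n)} {i : Fin n} (h : Proves Γ i Δ)
    (hle : Γ ≤ Γ') : Proves Γ' i Δ := by
  obtain ⟨Γ'', rfl⟩ := Multiset.le_iff_exists_add.mp hle
  rw [add_comm]
  exact h.weaken_left Γ''

/-- If `F` entails itself at `i`, then `F^{(ij)}, F^{(kj)} ⊢_j` for every `k ≠ i`. -/
theorem Proves.two_negations {n : ℕ} {F : Fm n} {i k : Fin n} (h : Proves {F} i {F})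
    (j : Fin n) (hik : i ≠ k) :
    Proves {Fm.act (Equiv.swap i j) F, Fm.act (Equiv.swap k j) F} j 0 := by
  have := Proves.neg1 {F.act (Equiv.swap i j)} 0 F i j k hik
    (by simpa [actM, Fm.act_swap_act_swap] using h)
  rw [Equiv.swap_comm k j, Multiset.pair_comm]
  exact this

/-- The identity axiom holds for arbitrary formulas. -/
theorem Proves.refl {n : ℕ} (F : Fm n) (i : Fin n) : Proves {F} i {F} := by
  induction F generalizing i with
  | var X π => exact .id X π π i rfl
  | const k =>
    by_cases hki : i = k
    · subst hki
      exact (Proves.const i).weakL _ _ _ _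
    · have := Proves.neg1 0 0 (.const i) i i k hki (by simpa [actM] using Proves.const i)
      simp only [Fm.act, Equiv.swap_apply_left] at this
      exact this.weakR _ _ _ _
  | q F G ihF ihG =>
    refine .qL 0 _ F G i fun j => .qR _ 0 F _ j fun k => ?_
    by_cases hkj : k = j
    · subst hkj
      have hG : Proves {(G k).act (Equiv.swap k i)} k {(G k).act (Equiv.swap k i)} := by
        refine .sym _ _ i k ?_
        simpa [actM, Equiv.swap_comm i k, Fm.act_swap_act_swap] using ihG k i
      have := hG.mono_left (Γ' := F ::ₘ actM 1 {(G k).act (Equiv.swap k i), F})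
        (by simp [actM, Fm.act_one])
      simpa [actM, ← Equiv.Perm.one_def, Fm.act_one] using this
    · have hF := (ihF k).two_negations k (Ne.intro hkj)
      rw [Equiv.swap_self, ← Equiv.Perm.one_def, Fm.act_one, Equiv.swap_comm] at hF
      refine Proves.mono_left (hF.weakR _ _ _ _) ?_
      simp [actM, Multiset.cons_le_cons_iff]

/-- For every nPC formula `F` and all `i, j, k` with `i ≠ k`, the sequent
`F^{(ij)}, F^{(kj)} ⊢_j` (empty right-hand side) is provable. -/
theorem two_negations_inconsistent (n : ℕ) (hn : 2 ≤ n) (F : Fm n) (i j k : Fin n)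
    (hik : i ≠ k) :
    Proves {Fm.act (Equiv.swap i j) F, Fm.act (Equiv.swap k j) F} j 0 :=
  (Proves.refl F i).two_negations j hik
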